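/- Fix integers T ≥ 1 and n ≥ 1, matrices A_t ∈ ℝ^{n×n} and symmetric positive definite W_t (t = 0,…,T−1), a symmetric positive definite P_0, and symmetric positive semidefinite Θ_t and reals D_t > 0 (t = 1,…,T). Then there exist reals α_t ≥ 0 (t = 1,…,T) such that any minimizer of the max-det objective J(Π_1,…,Π_T) = −Σ_{t=1}^{T} ½ log det Π_t + c over the max-det feasible set F is also a minimizer of the soft objective J_α(P_1,…,P_T, Π_1,…,Π_T) = Σ_{t=1}^{T} [(α_t/2) Tr(Θ_t P_t) − ½ log det Π_t] + c over the soft max-det feasible set F₀ (the set obtained from F by dropping the trace constraints Tr(Θ_t P_t) ≤ D_t). -/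

import Mathlib

open Matrix

/-- The max-det feasible set `F`. -/
def maxdetFeasible (n T : ℕ) (A W Θ : ℕ → Matrix (Fin n) (Fin n) ℝ)
    (P₀ : Matrix (Fin n) (Fin n) ℝ) (D : ℕ → ℝ) :
    Set ((ℕ → Matrix (Fin n) (Fin n) ℝ) × (ℕ → Matrix (Fin n) (Fin n) ℝ)) :=
  {PQ | PQ.1 0 = P₀ ∧
    (∀ t, 1 ≤ t → t ≤ T → (PQ.2 t).PosDef) ∧
    (∀ t, t < T → (A t * PQ.1 t * (A t)ᵀ + W t - PQ.1 (t + 1)).PosSemidef) ∧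
    (∀ t, 1 ≤ t → t < T →
      (fromBlocks (PQ.1 t - PQ.2 t) (PQ.1 t * (A t)ᵀ) (A t * PQ.1 t)
        (W t + A t * PQ.1 t * (A t)ᵀ)).PosSemidef) ∧
    (∀ t, 1 ≤ t → t ≤ T → (Θ t * PQ.1 t).trace ≤ D t) ∧
    PQ.1 T = PQ.2 T}

/-- The soft max-det feasible set `F₀`: `F` without the trace constraints. -/
def softMaxdetFeasible (n T : ℕ) (A W : ℕ → Matrix (Fin n) (Fin n) ℝ)
    (P₀ : Matrix (Fin n) (Fin n) ℝ) :
    Set ((ℕ → Matrix (Fin n) (Fin n) ℝ) × (ℕ → Matrix (Fin n) (Fin n) ℝ)) :=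
  {PQ | PQ.1 0 = P₀ ∧
    (∀ t, 1 ≤ t → t ≤ T → (PQ.2 t).PosDef) ∧
    (∀ t, t < T → (A t * PQ.1 t * (A t)ᵀ + W t - PQ.1 (t + 1)).PosSemidef) ∧
    (∀ t, 1 ≤ t → t < T →
      (fromBlocks (PQ.1 t - PQ.2 t) (PQ.1 t * (A t)ᵀ) (A t * PQ.1 t)
        (W t + A t * PQ.1 t * (A t)ᵀ)).PosSemidef) ∧
    PQ.1 T = PQ.2 T}

/-- The constant `c = ½ log det (A 0 P₀ (A 0)ᵀ + W 0) + Σ_{t=1}^{T−1} ½ log det (W t)`. -/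
noncomputable def maxdetConst (n T : ℕ) (A W : ℕ → Matrix (Fin n) (Fin n) ℝ)
    (P₀ : Matrix (Fin n) (Fin n) ℝ) : ℝ :=
  (1 / 2) * Real.log (A 0 * P₀ * (A 0)ᵀ + W 0).det +
    ∑ t ∈ Finset.Ico 1 T, (1 / 2) * Real.log (W t).det

/-- The max-det objective `J(Π) = −Σ_{t=1}^{T} ½ log det (Π t) + c`. -/
noncomputable def maxdetObj (n T : ℕ) (A W : ℕ → Matrix (Fin n) (Fin n) ℝ)
    (P₀ : Matrix (Fin n) (Fin n) ℝ) (Q : ℕ → Matrix (Fin n) (Fin n) ℝ) : ℝ :=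
  -∑ t ∈ Finset.Icc 1 T, (1 / 2) * Real.log (Q t).det + maxdetConst n T A W P₀

/-- The soft objective
`J_α(P, Π) = Σ_{t=1}^{T} [(α t / 2) Tr(Θ t * P t) − ½ log det (Π t)] + c`. -/
noncomputable def softMaxdetObj (n T : ℕ) (A W Θ : ℕ → Matrix (Fin n) (Fin n) ℝ)
    (P₀ : Matrix (Fin n) (Fin n) ℝ) (α : ℕ → ℝ)
    (PQ : (ℕ → Matrix (Fin n) (Fin n) ℝ) × (ℕ → Matrix (Fin n) (Fin n) ℝ)) : ℝ :=
  ∑ t ∈ Finset.Icc 1 T,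
    ((α t / 2) * (Θ t * PQ.1 t).trace - (1 / 2) * Real.log (PQ.2 t).det) +
    maxdetConst n T A W P₀

/-- **Lagrange multipliers for convex programs under Slater's condition**: if `m` bounds `f` from
below on the feasible set, then it bounds some Lagrangian from below on all of `S`. -/
theorem ConvexOn.exists_lagrange_multipliers {E ι : Type*} [AddCommGroup E] [Module ℝ E]
    [Fintype ι] {S : Set E} {f : E → ℝ} {g : ι → E → ℝ} {m : ℝ} (hf : ConvexOn ℝ S f)
    (hg : ∀ i, ConvexOn ℝ S (g i)) {x₀ : E} (hx₀ : x₀ ∈ S) (hslater : ∀ i, g i x₀ < 0)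
    (hm : ∀ x ∈ S, (∀ i, g i x ≤ 0) → m ≤ f x) :
    ∃ l : ι → ℝ, (∀ i, 0 ≤ l i) ∧ ∀ x ∈ S, m ≤ f x + ∑ i, l i * g i x := by
  classical
  let C : Set ((ι → ℝ) × ℝ) := {u | ∃ x ∈ S, (∀ i, g i x < u.1 i) ∧ f x < u.2}
  have hconv : Convex ℝ C := by
    rintro u ⟨x, hx, hxg, hxf⟩ v ⟨y, hy, hyg, hyf⟩ a b ha hb hab
    have hlt : ∀ {s t s' t' : ℝ}, s < s' → t < t' → a * s + b * t < a * s' + b * t' := by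
      intro s t s' t' hs ht
      rcases ha.eq_or_lt with rfl | ha
      · have : b = 1 := by linarith
        simpa [this] using ht
      · exact add_lt_add_of_lt_of_le (mul_lt_mul_of_pos_left hs ha)
          (mul_le_mul_of_nonneg_left ht.le hb)
    refine ⟨a • x + b • y, hf.1 hx hy ha hb hab, fun i => ?_, ?_⟩
    · exact ((hg i).2 hx hy ha hb hab).trans_lt (hlt (hxg i) (hyg i))
    · exact (hf.2 hx hy ha hb hab).trans_lt (hlt hxf hyf)
  have hopen : IsOpen C := by
    have hC : C = ⋃ x ∈ S, ((⋂ i, {u : (ι → ℝ) × ℝ | g i x < u.1 i}) ∩ {u | f x < u.2}) := by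
      ext u
      simp only [C, Set.mem_ofPred_eq, Set.mem_iUnion, Set.mem_inter_iff, Set.mem_iInter,
        exists_prop]
    rw [hC]
    refine isOpen_biUnion fun x _ => IsOpen.inter (isOpen_iInter_of_finite fun i => ?_) ?_
    · exact isOpen_lt continuous_const (by fun_prop)
    · exact isOpen_lt continuous_const continuous_snd
  have hnot : ((0 : ι → ℝ), m) ∉ C := by
    rintro ⟨x, hx, hxg, hxf⟩
    exact absurd (hm x hx fun i => (hxg i).le) (not_le.mpr hxf)
  obtain ⟨φ, hφ⟩ := geometric_hahn_banach_open_point hconv hopen hnot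
  set p : ι → ℝ := fun i => φ (Pi.single i 1, 0) with hp
  set q : ℝ := φ (0, 1) with hq
  have hφ_eq : ∀ u r, φ (u, r) = ∑ i, p i * u i + q * r := by
    intro u r
    have hu : (u, r) =
        ∑ i, u i • ((Pi.single i 1 : ι → ℝ), (0 : ℝ)) + r • ((0 : ι → ℝ), (1 : ℝ)) := by
      refine Prod.ext ?_ ?_
      · simp only [Prod.fst_add, Prod.fst_sum, Prod.smul_fst, smul_zero, add_zero]
        exact pi_eq_sum_univ' u
      · simp [Prod.snd_sum]
    rw [hu, map_add, map_sum]
    simp only [map_smul, smul_eq_mul, hp, hq]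
    congr 1
    · exact Finset.sum_congr rfl fun i _ => mul_comm _ _
    · exact mul_comm _ _
  have hsep : ∀ x ∈ S, ∀ (u : ι → ℝ) r, (∀ i, g i x < u i) → f x < r →
      ∑ i, p i * u i + q * r < q * m := by
    intro x hx u r hu hr
    have := hφ (u, r) ⟨x, hx, hu, hr⟩
    rw [hφ_eq, hφ_eq] at this
    simpa using this
  have nonpos_of_bdd : ∀ {a b c : ℝ}, (∀ k : ℝ, 0 ≤ k → a + c * k < b) → c ≤ 0 := by
    intro a b c h
    by_contra! hc
    have h0 := h 0 le_rfl
    have h1 := h ((b - a) / c) (div_nonneg (by linarith) hc.le)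
    rw [mul_div_cancel₀ _ hc.ne'] at h1
    linarith
  have hp_nonpos : ∀ i, p i ≤ 0 := by
    intro i
    refine nonpos_of_bdd (a := q * (f x₀ + 1)) (b := q * m) fun k hk => ?_
    have := hsep x₀ hx₀ (Pi.single i k) (f x₀ + 1) (fun j => (hslater j).trans_le ?_) (by linarith)
    · simp only [Pi.single_apply, mul_ite, mul_zero, Finset.sum_ite_eq', Finset.mem_univ,
        if_true] at this
      linarith
    · rw [Pi.single_apply]
      split_ifs <;> simp [hk]
  have hq_neg : q < 0 := by
    refine lt_of_le_of_ne (nonpos_of_bdd (a := q * (f x₀ + 1)) (b := q * m) fun k hk => ?_) ?_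
    · have := hsep x₀ hx₀ 0 (f x₀ + 1 + k) hslater (by linarith)
      simp only [Pi.zero_apply, mul_zero, Finset.sum_const_zero, zero_add] at this
      linarith
    · intro hq0
      have := hsep x₀ hx₀ 0 (f x₀ + 1) hslater (by linarith)
      simp [hq0] at this
  refine ⟨fun i => p i / q, fun i => div_nonneg_of_nonpos (hp_nonpos i) hq_neg.le, fun x hx => ?_⟩
  have hle : ∑ i, p i * g i x + q * f x ≤ q * m := by
    have hlim : Filter.Tendsto (fun ε : ℝ => ∑ i, p i * (g i x + ε) + q * (f x + ε))
        (nhdsWithin 0 (Set.Ioi 0)) (nhds (∑ i, p i * (g i x + 0) + q * (f x + 0))) := by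
      refine Filter.Tendsto.mono_left (Continuous.tendsto ?_ 0) nhdsWithin_le_nhds
      fun_prop
    simp only [add_zero] at hlim
    refine le_of_tendsto hlim (Filter.eventually_of_mem self_mem_nhdsWithin fun ε hε => ?_)
    have hε' : (0 : ℝ) < ε := hε
    exact (hsep x hx (fun i => g i x + ε) (f x + ε) (fun i => by linarith) (by linarith)).le
  have hsum : ∑ i, p i / q * g i x = (∑ i, p i * g i x) / q := by
    rw [Finset.sum_div]
    exact Finset.sum_congr rfl fun i _ => by ring
  have hdiv : m ≤ (∑ i, p i * g i x + q * f x) / q := by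
    rw [le_div_iff_of_neg hq_neg]
    linarith
  rw [add_div, mul_div_cancel_left₀ _ hq_neg.ne] at hdiv
  rw [hsum]
  linarith

namespace Matrix.PosDef

variable {k : Type*} [Fintype k] [DecidableEq k]

theorem log_det_le_trace_sub_card {X : Matrix k k ℝ} (hX : X.PosDef) :
    Real.log X.det ≤ X.trace - Fintype.card k := by
  rw [hX.1.det_eq_prod_eigenvalues, hX.1.trace_eq_sum_eigenvalues]
  simp only [RCLike.ofReal_real_eq_id, id_eq]
  rw [Real.log_prod fun i _ => (hX.eigenvalues_pos i).ne']
  calc ∑ i, Real.log (hX.1.eigenvalues i) ≤ ∑ i, (hX.1.eigenvalues i - 1) :=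
        Finset.sum_le_sum fun i _ => Real.log_le_sub_one_of_pos (hX.eigenvalues_pos i)
    _ = _ := by simp

open scoped MatrixOrder in
/-- The tangent-plane bound for `log det` at `Y`. -/
theorem log_det_sub_log_det_le {X Y : Matrix k k ℝ} (hX : X.PosDef) (hY : Y.PosDef) :
    Real.log X.det - Real.log Y.det ≤ (Y⁻¹ * X).trace - Fintype.card k := by
  obtain ⟨M, hM, hYM⟩ := CStarAlgebra.isStrictlyPositive_iff_eq_star_mul_self.mp
    hY.inv.isStrictlyPositive
  have hMX : (M * X * star M).PosDef := (Matrix.IsUnit.posDef_star_right_conjugate_iff hM).mpr hX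
  have hdet : (M * X * star M).det = X.det * (Y.det)⁻¹ := by
    have hY' : (Y⁻¹).det = (star M).det * M.det := by rw [hYM, Matrix.det_mul]
    rw [Matrix.det_nonsing_inv, Ring.inverse_eq_inv'] at hY'
    rw [Matrix.det_mul, Matrix.det_mul, hY']
    ring
  have htrace : (M * X * star M).trace = (Y⁻¹ * X).trace := by
    rw [hYM, Matrix.trace_mul_comm, Matrix.mul_assoc]
  have h := hMX.log_det_le_trace_sub_card
  rwa [hdet, htrace, Real.log_mul hX.det_pos.ne' (inv_ne_zero hY.det_pos.ne'), Real.log_inv,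
    ← sub_eq_add_neg] at h

end Matrix.PosDef

theorem Matrix.concaveOn_log_det {k : Type*} [Fintype k] [DecidableEq k] :
    ConcaveOn ℝ {X : Matrix k k ℝ | X.PosDef} fun X => Real.log X.det := by
  have hconv : Convex ℝ {X : Matrix k k ℝ | X.PosDef} := by
    intro X hX Y hY a b ha hb hab
    rcases ha.eq_or_lt with rfl | ha
    · obtain rfl : b = 1 := by linarith
      simpa using hY
    · exact (hX.smul ha).add_posSemidef (hY.posSemidef.smul hb)
  refine ⟨hconv, fun X hX Y hY a b ha hb hab => ?_⟩
  have hZ : (a • X + b • Y).PosDef := hconv hX hY ha hb hab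
  have h1 := mul_le_mul_of_nonneg_left (hX.log_det_sub_log_det_le hZ) ha
  have h2 := mul_le_mul_of_nonneg_left (hY.log_det_sub_log_det_le hZ) hb
  have htr : a * ((a • X + b • Y)⁻¹ * X).trace + b * ((a • X + b • Y)⁻¹ * Y).trace
      = Fintype.card k := by
    have hdet := (Matrix.isUnit_iff_isUnit_det _).mp hZ.isUnit
    have := congrArg Matrix.trace (Matrix.nonsing_inv_mul _ hdet)
    rw [Matrix.trace_one, Matrix.mul_add, Matrix.trace_add, Matrix.mul_smul, Matrix.mul_smul,
      Matrix.trace_smul, Matrix.trace_smul] at this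
    simpa only [smul_eq_mul] using this
  obtain rfl : b = 1 - a := by linarith
  simp only [smul_eq_mul]
  linarith

/-- The matrix `Q = (P⁻¹ + Aᵀ W⁻¹ A)⁻¹` makes the Schur complement of the block matrix vanish. -/
theorem Matrix.PosDef.exists_posSemidef_fromBlocks {k : Type*} [Fintype k] [DecidableEq k]
    {P W : Matrix k k ℝ} (hP : P.PosDef) (hW : W.PosDef) (A : Matrix k k ℝ) :
    ∃ Q : Matrix k k ℝ, Q.PosDef ∧
      (fromBlocks (P - Q) (P * Aᵀ) (A * P) (W + A * P * Aᵀ)).PosSemidef := by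
  have hV : (W + A * P * Aᵀ).PosDef := by
    simpa using hW.add_posSemidef (hP.posSemidef.mul_mul_conjTranspose_same A)
  have hQ : (P⁻¹ + Aᵀ * W⁻¹ * A)⁻¹.PosDef := by
    simpa using
      (hP.inv.add_posSemidef (hW.inv.posSemidef.conjTranspose_mul_mul_same A)).inv
  have hdetP := (Matrix.isUnit_iff_isUnit_det _).mp hP.isUnit
  have hdetW := (Matrix.isUnit_iff_isUnit_det _).mp hW.isUnit
  have hwood := Matrix.add_mul_mul_inv_eq_sub P⁻¹ Aᵀ W⁻¹ A hP.inv.isUnit hW.inv.isUnit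
    (by simpa [Matrix.nonsing_inv_nonsing_inv _ hdetP, Matrix.nonsing_inv_nonsing_inv _ hdetW]
      using hV.isUnit)
  rw [Matrix.nonsing_inv_nonsing_inv _ hdetP, Matrix.nonsing_inv_nonsing_inv _ hdetW] at hwood
  refine ⟨_, hQ, ?_⟩
  have : Invertible (W + A * P * Aᵀ) := hV.isUnit.invertible
  have hPt : Pᵀ = P := by simpa using hP.1.eq
  have hB : A * P = (P * Aᵀ)ᴴ := by simp [hPt]
  have hschur := (Matrix.PosDef.fromBlocks₂₂ (P - (P⁻¹ + Aᵀ * W⁻¹ * A)⁻¹) (P * Aᵀ) hV).mpr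
  rw [← hB, hwood] at hschur
  rw [hwood]
  exact hschur (by simp [Matrix.mul_assoc, Matrix.PosSemidef.zero])

theorem maxdetFeasible_eq (n T : ℕ) (A W Θ : ℕ → Matrix (Fin n) (Fin n) ℝ)
    (P₀ : Matrix (Fin n) (Fin n) ℝ) (D : ℕ → ℝ) :
    maxdetFeasible n T A W Θ P₀ D = {PQ | PQ ∈ softMaxdetFeasible n T A W P₀ ∧
      ∀ t, 1 ≤ t → t ≤ T → (Θ t * PQ.1 t).trace ≤ D t} := by
  ext PQ
  simp only [maxdetFeasible, softMaxdetFeasible, Set.mem_ofPred_eq]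
  tauto

theorem softMaxdetObj_eq (n T : ℕ) (A W Θ : ℕ → Matrix (Fin n) (Fin n) ℝ)
    (P₀ : Matrix (Fin n) (Fin n) ℝ) (α : ℕ → ℝ)
    (PQ : (ℕ → Matrix (Fin n) (Fin n) ℝ) × (ℕ → Matrix (Fin n) (Fin n) ℝ)) :
    softMaxdetObj n T A W Θ P₀ α PQ = maxdetObj n T A W P₀ PQ.2 +
      ∑ t ∈ Finset.Icc 1 T, (α t / 2) * (Θ t * PQ.1 t).trace := by
  rw [softMaxdetObj, maxdetObj, Finset.sum_sub_distrib]
  ring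

theorem convex_softMaxdetFeasible (n T : ℕ) (A W : ℕ → Matrix (Fin n) (Fin n) ℝ)
    (P₀ : Matrix (Fin n) (Fin n) ℝ) : Convex ℝ (softMaxdetFeasible n T A W P₀) := by
  rintro ⟨P, Q⟩ ⟨hP0, hQ, hPW, hPQ, hT⟩ ⟨P', Q'⟩ ⟨hP0', hQ', hPW', hPQ', hT'⟩ a b ha hb hab
  simp only at hP0 hQ hPW hPQ hT hP0' hQ' hPW' hPQ' hT'
  have hsplit : ∀ M : Matrix (Fin n) (Fin n) ℝ, M = a • M + b • M := fun M => by
    rw [← add_smul, hab, one_smul]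
  simp only [softMaxdetFeasible, Set.mem_ofPred_eq, Prod.smul_mk, Prod.mk_add_mk, Pi.add_apply,
    Pi.smul_apply]
  refine ⟨?_, fun t h1 h2 => ?_, fun t ht => ?_, fun t h1 h2 => ?_, ?_⟩
  · rw [hP0, hP0', ← hsplit]
  · exact Matrix.concaveOn_log_det.1 (hQ t h1 h2) (hQ' t h1 h2) ha hb hab
  · convert ((hPW t ht).smul ha).add ((hPW' t ht).smul hb) using 1
    nth_rewrite 1 [hsplit (W t)]
    simp only [Matrix.mul_add, Matrix.add_mul, Matrix.mul_smul, Matrix.smul_mul, smul_add, smul_sub]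
    abel
  · convert ((hPQ t h1 h2).smul ha).add ((hPQ' t h1 h2).smul hb) using 1
    rw [Matrix.fromBlocks_smul, Matrix.fromBlocks_smul, Matrix.fromBlocks_add]
    nth_rewrite 1 [hsplit (W t)]
    simp only [Matrix.mul_add, Matrix.add_mul, Matrix.mul_smul, Matrix.smul_mul, smul_add, smul_sub]
    congr 1 <;> abel
  · rw [hT, hT']

theorem convexOn_maxdetObj (n T : ℕ) (A W : ℕ → Matrix (Fin n) (Fin n) ℝ)
    (P₀ : Matrix (Fin n) (Fin n) ℝ) :
    ConvexOn ℝ (softMaxdetFeasible n T A W P₀) fun PQ => maxdetObj n T A W P₀ PQ.2 := by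
  refine ⟨convex_softMaxdetFeasible n T A W P₀, fun X hX Y hY a b ha hb hab => ?_⟩
  have hsum : a * ∑ t ∈ Finset.Icc 1 T, (1 / 2) * Real.log (X.2 t).det +
      b * ∑ t ∈ Finset.Icc 1 T, (1 / 2) * Real.log (Y.2 t).det ≤
      ∑ t ∈ Finset.Icc 1 T, (1 / 2) * Real.log ((a • X + b • Y).2 t).det := by
    rw [Finset.mul_sum, Finset.mul_sum, ← Finset.sum_add_distrib]
    refine Finset.sum_le_sum fun t ht => ?_
    obtain ⟨h1, h2⟩ := Finset.mem_Icc.mp ht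
    have h := Matrix.concaveOn_log_det.2 (hX.2.1 t h1 h2) (hY.2.1 t h1 h2) ha hb hab
    simp only [smul_eq_mul] at h
    simp only [Prod.snd_add, Prod.smul_snd, Pi.add_apply, Pi.smul_apply]
    linarith
  obtain rfl : b = 1 - a := by linarith
  simp only [maxdetObj, smul_eq_mul]
  linarith

/-- Slater's condition: the trace constraints can be made strict. -/
theorem exists_mem_softMaxdetFeasible_trace_lt (n T : ℕ)
    (A W Θ : ℕ → Matrix (Fin n) (Fin n) ℝ) (P₀ : Matrix (Fin n) (Fin n) ℝ) (D : ℕ → ℝ)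
    (hW : ∀ t, t < T → (W t).PosDef) (hP₀ : P₀.PosDef) (hD : ∀ t, 1 ≤ t → t ≤ T → 0 < D t) :
    ∃ PQ ∈ softMaxdetFeasible n T A W P₀,
      ∀ t, 1 ≤ t → t ≤ T → (Θ t * PQ.1 t).trace < D t := by
  have hscale : ∀ t, t < T → ∃ s : ℝ, 0 < s ∧ s ≤ 1 ∧ s * (Θ (t + 1) * W t).trace < D (t + 1) := by
    intro t ht
    have hDt := hD (t + 1) (by omega) (by omega)
    set x := (Θ (t + 1) * W t).trace
    have hx : 0 < D (t + 1) + |x| + 1 := by positivity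
    refine ⟨D (t + 1) / (D (t + 1) + |x| + 1), by positivity, ?_, ?_⟩
    · rw [div_le_one hx]
      linarith [abs_nonneg x]
    · rw [div_mul_eq_mul_div, div_lt_iff₀ hx]
      exact mul_lt_mul_of_pos_left (by linarith [le_abs_self x]) hDt
  choose! s hs_pos hs_le hs_lt using hscale
  let P : ℕ → Matrix (Fin n) (Fin n) ℝ := fun t => Nat.casesOn t P₀ fun t => s t • W t
  have hP : ∀ t, t ≤ T → (P t).PosDef := by
    intro t ht
    cases t with
    | zero => exact hP₀
    | succ t => exact (hW t ht).smul (hs_pos t ht)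
  have hQ : ∀ t, t < T → ∃ Q : Matrix (Fin n) (Fin n) ℝ, Q.PosDef ∧
      (fromBlocks (P t - Q) (P t * (A t)ᵀ) (A t * P t) (W t + A t * P t * (A t)ᵀ)).PosSemidef :=
    fun t ht => (hP t ht.le).exists_posSemidef_fromBlocks (hW t ht) (A t)
  choose! Q hQ_pos hQ_block using hQ
  refine ⟨(P, fun t => if t < T then Q t else P t), ⟨rfl, fun t _ h2 => ?_, fun t ht => ?_,
    fun t _ h2 => ?_, by simp⟩, fun t h1 h2 => ?_⟩
  · by_cases ht : t < T
    · simpa [ht] using hQ_pos t ht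
    · simpa [ht] using hP t h2
  · have h1 : (A t * P t * (A t)ᵀ).PosSemidef := by
      simpa using (hP t ht.le).posSemidef.mul_mul_conjTranspose_same (A t)
    have h2 := h1.add ((hW t ht).posSemidef.smul (sub_nonneg.mpr (hs_le t ht)))
    rwa [sub_smul, one_smul, ← add_sub_assoc] at h2
  · simpa [h2] using hQ_block t h2
  · obtain ⟨t, rfl⟩ : ∃ r, t = r + 1 := ⟨t - 1, by omega⟩
    simpa [P] using hs_lt t h2

/-- There exist Lagrange multipliers `α t ≥ 0` (for `t = 1, …, T`) such
that any minimizer of the max-det objective over `F` is also a minimizer of the soft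
objective over `F₀`. -/
theorem hard_soft_equivalence (n T : ℕ) (hn : 0 < n) (hT : 1 ≤ T)
    (A W Θ : ℕ → Matrix (Fin n) (Fin n) ℝ) (P₀ : Matrix (Fin n) (Fin n) ℝ)
    (D : ℕ → ℝ)
    (hW : ∀ t, t < T → (W t).PosDef) (hP₀ : P₀.PosDef)
    (hΘ : ∀ t, 1 ≤ t → t ≤ T → (Θ t).PosSemidef)
    (hD : ∀ t, 1 ≤ t → t ≤ T → 0 < D t) :
    ∃ α : ℕ → ℝ, (∀ t, 1 ≤ t → t ≤ T → 0 ≤ α t) ∧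
      ∀ PQ ∈ maxdetFeasible n T A W Θ P₀ D,
        (∀ PQ' ∈ maxdetFeasible n T A W Θ P₀ D,
          maxdetObj n T A W P₀ PQ.2 ≤ maxdetObj n T A W P₀ PQ'.2) →
        PQ ∈ softMaxdetFeasible n T A W P₀ ∧
        ∀ PQ' ∈ softMaxdetFeasible n T A W P₀,
          softMaxdetObj n T A W Θ P₀ α PQ ≤ softMaxdetObj n T A W Θ P₀ α PQ' := by
  classical
  by_cases hmin : ∃ PQ ∈ maxdetFeasible n T A W Θ P₀ D, ∀ PQ' ∈ maxdetFeasible n T A W Θ P₀ D,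
      maxdetObj n T A W P₀ PQ.2 ≤ maxdetObj n T A W P₀ PQ'.2
  swap
  · exact ⟨0, fun _ _ _ => le_rfl, fun PQ hPQ h => absurd ⟨PQ, hPQ, h⟩ hmin⟩
  obtain ⟨PQ₀, hPQ₀, hPQ₀_min⟩ := hmin
  obtain ⟨S₀, hS₀, hS₀_lt⟩ :=
    exists_mem_softMaxdetFeasible_trace_lt n T A W Θ P₀ D hW hP₀ hD
  have hconvex := convexOn_maxdetObj n T A W P₀
  obtain ⟨l, hl_nonneg, hl⟩ := hconvex.exists_lagrange_multipliers
    (g := fun (t : Finset.Icc 1 T) PQ => (Θ t * PQ.1 t).trace - D t)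
    (m := maxdetObj n T A W P₀ PQ₀.2)
    (fun t => ⟨hconvex.1, fun X _ Y _ a b _ _ hab => by
      obtain rfl : b = 1 - a := by linarith
      simp only [Prod.fst_add, Prod.smul_fst, Pi.add_apply, Pi.smul_apply, Matrix.mul_add,
        Matrix.mul_smul, Matrix.trace_add, Matrix.trace_smul, smul_eq_mul]
      linarith⟩)
    hS₀
    (fun t => sub_neg.mpr
      (hS₀_lt t (Finset.mem_Icc.mp t.2).1 (Finset.mem_Icc.mp t.2).2))
    (fun PQ hPQ hg => hPQ₀_min PQ (by
      rw [maxdetFeasible_eq]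
      exact ⟨hPQ, fun t h1 h2 => sub_nonpos.mp (hg ⟨t, Finset.mem_Icc.mpr ⟨h1, h2⟩⟩)⟩))
  let α : ℕ → ℝ := fun t => if ht : t ∈ Finset.Icc 1 T then 2 * l ⟨t, ht⟩ else 0
  have hα : ∀ t, 0 ≤ α t := by
    intro t
    by_cases ht : t ∈ Finset.Icc 1 T
    · simpa only [α, dif_pos ht] using mul_nonneg zero_le_two (hl_nonneg _)
    · simp only [α, dif_neg ht, le_refl]
  have hsum : ∀ PQ : (ℕ → Matrix (Fin n) (Fin n) ℝ) × (ℕ → Matrix (Fin n) (Fin n) ℝ),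
      ∑ t : Finset.Icc 1 T, l t * ((Θ t * PQ.1 t).trace - D t) =
        ∑ t ∈ Finset.Icc 1 T, (α t / 2) * (Θ t * PQ.1 t).trace -
          ∑ t ∈ Finset.Icc 1 T, (α t / 2) * D t := by
    intro PQ
    rw [← Finset.sum_sub_distrib, ← Finset.sum_coe_sort (Finset.Icc 1 T)]
    refine Finset.sum_congr rfl fun t _ => ?_
    simp only [α, dif_pos t.2]
    ring
  refine ⟨α, fun t _ _ => hα t, fun PQ hPQ hPQ_min => ?_⟩
  rw [maxdetFeasible_eq] at hPQ
  refine ⟨hPQ.1, fun PQ' hPQ' => ?_⟩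
  have hle := hPQ_min PQ₀ hPQ₀
  have hlag := hl PQ' hPQ'
  rw [hsum] at hlag
  have htrace : ∑ t ∈ Finset.Icc 1 T, (α t / 2) * (Θ t * PQ.1 t).trace ≤
      ∑ t ∈ Finset.Icc 1 T, (α t / 2) * D t :=
    Finset.sum_le_sum fun t ht => mul_le_mul_of_nonneg_left
      (hPQ.2 t (Finset.mem_Icc.mp ht).1 (Finset.mem_Icc.mp ht).2) (by linarith [hα t])
  rw [softMaxdetObj_eq, softMaxdetObj_eq]
  linarith
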